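/- arXiv:0902.3749 — 4 statements merged into one kernel-verified Lean document; each statement's English description precedes it below -/
import Mathlib

section
/- Let α be a type and ε : (α → Prop) → α. If ε satisfies (E2), i.e. for all predicates A0, A1 : α → Prop, (∀ x, A0 x ↔ A1 x) implies ε A0 = ε A1, and ε satisfies (ε5), i.e. ε (fun _ => False) = ε (fun _ => True), then ε satisfies (vext), i.e. for all A0, A1, (∀ x, (((∃ y, A0 y) → A0 x)) ↔ ((∃ y, A1 y) → A1 x)) implies ε A0 = ε A1. -/
/-- If an ε-operator satisfies Ackermann's (E2) and Hermes' (ε5),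
then it satisfies deVidi's (vext) (classical logic). -/
theorem E2_and_eps5_implies_vext {α : Type*} (ε : (α → Prop) → α)
    (hE2 : ∀ A0 A1 : α → Prop, (∀ x, A0 x ↔ A1 x) → ε A0 = ε A1)
    (heps5 : ε (fun _ => False) = ε (fun _ => True)) :
    ∀ A0 A1 : α → Prop,
      (∀ x, (((∃ y, A0 y) → A0 x)) ↔ ((∃ y, A1 y) → A1 x)) → ε A0 = ε A1 := by
  have key : ∀ A : α → Prop, ε A = ε (fun x => (∃ y, A y) → A x) := by
    intro A
    by_cases h : ∃ y, A y
    · exact hE2 _ _ fun x => ⟨fun hx _ => hx, fun hx => hx h⟩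
    · have h1 : ε A = ε (fun _ => False) :=
        hE2 _ _ fun x => ⟨fun hx => h ⟨x, hx⟩, False.elim⟩
      have h2 : ε (fun _ => True) = ε (fun x => (∃ y, A y) → A x) :=
        hE2 _ _ fun x => ⟨fun _ hy => absurd hy h, fun _ => trivial⟩
      exact h1.trans (heps5.trans h2)
  intro A0 A1 h
  exact (key A0).trans ((hE2 _ _ h).trans (key A1).symm)
end

section
/- Let α be a type with elements z o : α such that z ≠ o, let ε : (α → Prop) → α satisfy the ε-formula, i.e. for every predicate A : α → Prop and every t : α, A t → A (ε A). For a proposition B define A0 := fun x => B ∨ x = z and A1 := fun x => B ∨ x = o. Then B ∨ ε A0 ≠ ε A1. -/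
/-- Claims 1 and 2 combined: with two distinct elements, an ε satisfying
the ε-formula separates the two test predicates unless B holds. -/
theorem claims1and2 {α : Type*} (z o : α) (hzo : z ≠ o)
    (ε : (α → Prop) → α)
    (hef : ∀ (A : α → Prop) (t : α), A t → A (ε A)) (B : Prop) :
    B ∨ ε (fun x => B ∨ x = z) ≠ ε (fun x => B ∨ x = o) := by
  rcases hef (fun x => B ∨ x = z) z (Or.inr rfl) with hB | h0
  · exact Or.inl hB
  · rcases hef (fun x => B ∨ x = o) o (Or.inr rfl) with hB | h1
    · exact Or.inl hB
    · exact Or.inr fun h => hzo (h0.symm.trans (h.trans h1))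
end

section
/- Let α be a type with elements z o : α such that z ≠ o, and let ε : (α → Prop) → α satisfy the ε-formula, i.e. for every predicate A : α → Prop and every t : α, A t → A (ε A), and also the extensionality axiom (E2), i.e. for all predicates A0, A1, (∀ x, A0 x ↔ A1 x) → ε A0 = ε A1. For a proposition B define A0 := fun x => B ∨ x = z and A1 := fun x => B ∨ x = o. Then B ↔ (ε A0 = ε A1). (Consequently every proposition B is decided by ε, i.e. B ∨ ¬B; this is the content of the result that 0 ≠ 1 together with (E2) yields excluded middle.) -/
/-- With two distinct elements, an ε satisfying the ε-formula and (E2)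
decides every proposition B via the two test predicates. -/
theorem E2_decides {α : Type*} (z o : α) (hzo : z ≠ o)
    (ε : (α → Prop) → α)
    (hef : ∀ (A : α → Prop) (t : α), A t → A (ε A))
    (hE2 : ∀ A0 A1 : α → Prop, (∀ x, A0 x ↔ A1 x) → ε A0 = ε A1)
    (B : Prop) :
    B ↔ (ε (fun x => B ∨ x = z) = ε (fun x => B ∨ x = o)) := by
  constructor
  · intro hB
    exact hE2 _ _ (fun x => ⟨fun _ => Or.inl hB, fun _ => Or.inl hB⟩)
  · intro h
    rcases hef (fun x => B ∨ x = z) z (Or.inr rfl) with hB | h0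
    · exact hB
    · rcases hef (fun x => B ∨ x = o) o (Or.inr rfl) with hB | h1
      · exact hB
      · exact absurd (h0.symm.trans (h.trans h1)) hzo
end

section
/- Let α be a type and b : Set α → α. Then the following are equivalent: (i) for every a : Set α, if a is nonempty and any two elements of a are equal, then for every x : α, x = b a ↔ a = {x}; (ii) for every a : Set α, if there exists a unique x with x ∈ a, then b a ∈ a. (Peano's definition of the description operator ῑ is logically equivalent to the simplified axiom (ῑ0): if a has exactly one element, then ῑ a is an element of a.) -/
/-- Peano's original definition of the description operator ῑ is logically
equivalent to the simplified axiom (ῑ0). -/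
theorem peano_iota_equiv {α : Type*} (b : Set α → α) :
    (∀ a : Set α, a.Nonempty → (∀ x ∈ a, ∀ y ∈ a, x = y) →
        ∀ x : α, x = b a ↔ a = {x}) ↔
    (∀ a : Set α, (∃! x, x ∈ a) → b a ∈ a) := by
  constructor
  · rintro h a ⟨x, hx, hu⟩
    have e := (h a ⟨x, hx⟩ (fun y hy z hz => (hu y hy).trans (hu z hz).symm) (b a)).1 rfl
    exact (Set.eq_singleton_iff_unique_mem.1 e).1
  · rintro h a ⟨w, hw⟩ hs x
    have hb : b a ∈ a := h a ⟨w, hw, fun y hy => hs y hy w hw⟩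
    constructor
    · rintro rfl
      exact Set.eq_singleton_iff_unique_mem.2 ⟨hb, fun y hy => hs y hy _ hb⟩
    · intro e
      have hx : x ∈ a := (Set.eq_singleton_iff_unique_mem.1 e).1
      exact hs x hx _ hb
end
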